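/- arXiv:1608.08712 — 3 statements merged into one kernel-verified Lean document; each statement's English description precedes it below -/
import Mathlib

section
/- Fix n ∈ ℕ+ and T > 0, and assume that for every k < 2n the degree-k discrete Gaussian orthogonal polynomials for (n, T) and for (2n, 2T) exist. Then for all 0 < t₁ < T, 0 < t₂ < T and all x, y ∈ ℝ: K̃^ref_{t₁,t₂}(x, y; n, T) = K̃_{2t₁,2t₂}(x, y; 2n, 2T) + K̃_{2t₁,2t₂}(x, −y; 2n, 2T). -/
/-- The discrete Gaussian weight `w_{n,T}(s) = exp(-nTs²/2)`. -/
noncomputable def dgWeight (n : ℕ+) (T : ℝ) (s : ℝ) : ℝ :=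
  Real.exp (-((n : ℕ) : ℝ) * T * s ^ 2 / 2)

/-- `p` is the degree-`k` discrete Gaussian orthogonal polynomial for `(n, T)`:
it is monic of degree `k` and orthogonal to all lower powers on the lattice of
mesh `1/n` with weight `w_{n,T}`, all sums converging absolutely. -/
def IsDGOP (n : ℕ+) (T : ℝ) (k : ℕ) (p : Polynomial ℝ) : Prop :=
  p.Monic ∧ p.natDegree = k ∧
  ∀ j < k,
    Summable (fun m : ℤ => p.eval ((m : ℝ) / ((n : ℕ) : ℝ)) * ((m : ℝ) / ((n : ℕ) : ℝ)) ^ j *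
      dgWeight n T ((m : ℝ) / ((n : ℕ) : ℝ))) ∧
    (∑' m : ℤ, p.eval ((m : ℝ) / ((n : ℕ) : ℝ)) * ((m : ℝ) / ((n : ℕ) : ℝ)) ^ j *
      dgWeight n T ((m : ℝ) / ((n : ℕ) : ℝ))) = 0

/-- The squared norm `h^T_{n,k}` of a discrete Gaussian orthogonal polynomial. -/
noncomputable def dgNorm (n : ℕ+) (T : ℝ) (p : Polynomial ℝ) : ℝ :=
  (1 / ((n : ℕ) : ℝ)) * ∑' m : ℤ, (p.eval ((m : ℝ) / ((n : ℕ) : ℝ))) ^ 2 *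
    dgWeight n T ((m : ℝ) / ((n : ℕ) : ℝ))

/-- The discrete Fourier transform `S_{k,a}(x; n, T)` of the polynomial `p` (meant to be
the degree-`k` discrete Gaussian orthogonal polynomial for `(n, T)`). -/
noncomputable def Sdft (n : ℕ+) (a : ℝ) (p : Polynomial ℝ) (x : ℝ) : ℂ :=
  (1 / ((n : ℕ) : ℝ) : ℝ) * ∑' m : ℤ, (↑(p.eval ((m : ℝ) / ((n : ℕ) : ℝ))) : ℂ) *
    Complex.exp (-(((n : ℕ) : ℝ) : ℂ) * (a : ℂ) * (((m : ℝ) / ((n : ℕ) : ℝ) : ℝ) : ℂ) ^ 2 / 2) *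
    Complex.exp (Complex.I * (((n : ℕ) : ℝ) : ℂ) * (((m : ℝ) / ((n : ℕ) : ℝ) : ℝ) : ℂ) * (x : ℂ))

/-- The circle kernel `K̃_{t₁,t₂}(x, y; m, S)`, where `P k` is the degree-`k`
discrete Gaussian orthogonal polynomial for `(m, S)`. -/
noncomputable def Kcirc (m : ℕ+) (S : ℝ) (P : ℕ → Polynomial ℝ) (t₁ t₂ x y : ℝ) : ℂ :=
  ((((m : ℕ) : ℝ) / (2 * Real.pi) : ℝ) : ℂ) * ∑ k ∈ Finset.range (m : ℕ),
    ((dgNorm m S (P k) : ℝ) : ℂ)⁻¹ * Sdft m (S - t₁) (P k) x * Sdft m t₂ (P k) (-y)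

/-- The reflecting-wall kernel `K̃^ref_{t₁,t₂}(x, y; n, T)`, where `P k` is the degree-`k`
discrete Gaussian orthogonal polynomial for `(n, T)`. -/
noncomputable def Kref (n : ℕ+) (T : ℝ) (P : ℕ → Polynomial ℝ) (t₁ t₂ x y : ℝ) : ℂ :=
  ((((n : ℕ) : ℝ) / Real.pi : ℝ) : ℂ) * ∑ k ∈ Finset.range (n : ℕ),
    ((dgNorm n T (P (2 * k)) : ℝ) : ℂ)⁻¹ * Sdft n (T - t₁) (P (2 * k)) x *
      Sdft n t₂ (P (2 * k)) (-y)

section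

open Polynomial

/-- A discrete Gaussian orthogonal polynomial is orthogonal to every polynomial of lower degree. -/
theorem IsDGOP.hasSum_mul_eq_zero {n : ℕ+} {T : ℝ} {k : ℕ} {p : ℝ[X]} (hp : IsDGOP n T k p)
    {r : ℝ[X]} (hr : r.degree < k) :
    HasSum (fun m : ℤ => p.eval ((m : ℝ) / ((n : ℕ) : ℝ)) * r.eval ((m : ℝ) / ((n : ℕ) : ℝ)) *
      dgWeight n T ((m : ℝ) / ((n : ℕ) : ℝ))) 0 := by
  have hsum : HasSum (fun m : ℤ => ∑ j ∈ Finset.range k, r.coeff j *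
      (p.eval ((m : ℝ) / ((n : ℕ) : ℝ)) * ((m : ℝ) / ((n : ℕ) : ℝ)) ^ j *
        dgWeight n T ((m : ℝ) / ((n : ℕ) : ℝ)))) (∑ j ∈ Finset.range k, r.coeff j * 0) := by
    refine hasSum_sum fun j hj => HasSum.mul_left _ ?_
    obtain ⟨hs, h0⟩ := hp.2.2 j (Finset.mem_range.mp hj)
    exact h0 ▸ hs.hasSum
  simp only [mul_zero, Finset.sum_const_zero] at hsum
  refine hsum.congr_fun fun m => ?_
  have hev : r.eval ((m : ℝ) / ((n : ℕ) : ℝ)) =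
      ∑ j ∈ Finset.range k, r.coeff j * ((m : ℝ) / ((n : ℕ) : ℝ)) ^ j := by
    rcases eq_or_ne r 0 with rfl | h0
    · simp
    · exact eval_eq_sum_range' ((natDegree_lt_iff_degree_lt h0).mpr hr) _
  rw [hev, Finset.mul_sum, Finset.sum_mul]
  exact Finset.sum_congr rfl fun j _ => by ring

/-- Discrete Gaussian orthogonal polynomials are unique. -/
theorem IsDGOP.eq {n : ℕ+} {T : ℝ} {k : ℕ} {p p' : ℝ[X]} (hp : IsDGOP n T k p)
    (hp' : IsDGOP n T k p') : p = p' := by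
  have hn : ((n : ℕ) : ℝ) ≠ 0 := Nat.cast_ne_zero.mpr n.pos.ne'
  have hdeg : (p - p').degree < k := by
    have h := degree_sub_lt_left (p := p) (q := p')
      (by rw [degree_eq_natDegree hp.1.ne_zero, degree_eq_natDegree hp'.1.ne_zero, hp.2.1, hp'.2.1])
      hp.1.ne_zero (by rw [hp.1.leadingCoeff, hp'.1.leadingCoeff])
    rwa [degree_eq_natDegree hp.1.ne_zero, hp.2.1] at h
  have hsq : HasSum (fun m : ℤ => (p - p').eval ((m : ℝ) / ((n : ℕ) : ℝ)) ^ 2 *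
      dgWeight n T ((m : ℝ) / ((n : ℕ) : ℝ))) 0 := by
    have h := (hp.hasSum_mul_eq_zero hdeg).sub (hp'.hasSum_mul_eq_zero hdeg)
    rw [sub_zero] at h
    refine h.congr_fun fun m => ?_
    rw [eval_sub]
    ring
  have hw : ∀ s, 0 < dgWeight n T s := fun s => Real.exp_pos _
  have hzero := (hasSum_zero_iff_of_nonneg fun m : ℤ =>
    mul_nonneg (sq_nonneg _) (hw ((m : ℝ) / ((n : ℕ) : ℝ))).le).mp hsq
  refine sub_eq_zero.mp (eq_zero_of_infinite_isRoot _ ?_)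
  refine (Set.infinite_range_of_injective (f := fun m : ℤ => (m : ℝ) / ((n : ℕ) : ℝ))
    fun a b hab => ?_).mono ?_
  · exact_mod_cast (div_left_inj' hn).mp hab
  · rintro _ ⟨m, rfl⟩
    have h := congrFun hzero m
    simpa [(hw _).ne', IsRoot] using h

/-- The weight is even. -/
theorem dgWeight_neg (n : ℕ+) (T s : ℝ) : dgWeight n T (-s) = dgWeight n T s := by
  simp [dgWeight]

/-- Discrete Gaussian orthogonal polynomials have the parity of their degree. -/
theorem IsDGOP.eval_neg {n : ℕ+} {T : ℝ} {k : ℕ} {p : ℝ[X]} (hp : IsDGOP n T k p) (s : ℝ) :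
    p.eval (-s) = (-1) ^ k * p.eval s := by
  have hev (s : ℝ) : (p.scaleRoots (-1)).eval s = (-1) ^ k * p.eval (-s) := by
    have h := scaleRoots_eval₂_mul (p := p) (RingHom.id ℝ) (-s) (-1)
    simpa [hp.2.1, eval₂_id] using h
  have hq : IsDGOP n T k (p.scaleRoots (-1)) := by
    refine ⟨(monic_scaleRoots_iff _).mpr hp.1, by rw [natDegree_scaleRoots, hp.2.1], fun j hj => ?_⟩
    have h : HasSum (fun m : ℤ => p.eval ((m : ℝ) / ((n : ℕ) : ℝ)) *
        ((m : ℝ) / ((n : ℕ) : ℝ)) ^ j * dgWeight n T ((m : ℝ) / ((n : ℕ) : ℝ))) 0 :=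
      (hp.2.2 j hj).2 ▸ (hp.2.2 j hj).1.hasSum
    have h' := ((Equiv.neg ℤ).hasSum_iff.mpr h).mul_left ((-1) ^ k * (-1) ^ j)
    rw [mul_zero] at h'
    suffices hs : HasSum (fun m : ℤ => (p.scaleRoots (-1)).eval ((m : ℝ) / ((n : ℕ) : ℝ)) *
        ((m : ℝ) / ((n : ℕ) : ℝ)) ^ j * dgWeight n T ((m : ℝ) / ((n : ℕ) : ℝ))) 0 from
      ⟨hs.summable, hs.tsum_eq⟩
    refine h'.congr_fun fun m => ?_
    have hsq : ((-1 : ℝ) ^ j) * (-1) ^ j = 1 := by rw [← mul_pow]; simp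
    simp only [Function.comp_apply, Equiv.neg_apply, Int.cast_neg, neg_div, dgWeight_neg, hev]
    rw [neg_pow ((m : ℝ) / ((n : ℕ) : ℝ)) j]
    linear_combination (-(-1) ^ k * p.eval (-((m : ℝ) / ((n : ℕ) : ℝ))) *
      ((m : ℝ) / ((n : ℕ) : ℝ)) ^ j * dgWeight n T ((m : ℝ) / ((n : ℕ) : ℝ))) * hsq
  have h := hev (-s)
  rwa [← hp.eq hq, neg_neg] at h

/-- The weights for `(2n, 2T)` and `(n, T)` agree at corresponding lattice points. -/
theorem dgWeight_two_mul (n : ℕ+) (T s : ℝ) :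
    dgWeight (2 * n) (2 * T) (s / 2) = dgWeight n T s := by
  simp only [dgWeight, PNat.mul_coe, PNat.val_ofNat, Nat.cast_mul, Nat.cast_ofNat]
  ring_nf

theorem intCast_div_two_mul (n : ℕ+) (m : ℤ) :
    (m : ℝ) / (((2 * n : ℕ+) : ℕ) : ℝ) = (m : ℝ) / ((n : ℕ) : ℝ) / 2 := by
  simp only [PNat.mul_coe, PNat.val_ofNat, Nat.cast_mul, Nat.cast_ofNat]
  rw [div_div, mul_comm]

/-- The orthogonal polynomials for `(2n, 2T)` are rescalings of those for `(n, T)`. -/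
theorem IsDGOP.eval_eq_two_pow_mul {n : ℕ+} {T : ℝ} {k : ℕ} {p q : ℝ[X]} (hp : IsDGOP n T k p)
    (hq : IsDGOP (2 * n) (2 * T) k q) (s : ℝ) : p.eval s = 2 ^ k * q.eval (s / 2) := by
  have hev (s : ℝ) : (q.scaleRoots 2).eval s = 2 ^ k * q.eval (s / 2) := by
    have h := scaleRoots_eval₂_mul (p := q) (RingHom.id ℝ) (s / 2) 2
    simpa [hq.2.1, eval₂_id, mul_div_cancel₀] using h
  have hq' : IsDGOP n T k (q.scaleRoots 2) := by
    refine ⟨(monic_scaleRoots_iff _).mpr hq.1, by rw [natDegree_scaleRoots, hq.2.1], fun j hj => ?_⟩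
    have h := ((hq.2.2 j hj).2 ▸ (hq.2.2 j hj).1.hasSum).mul_left ((2 : ℝ) ^ k * 2 ^ j)
    rw [mul_zero] at h
    suffices hs : HasSum (fun m : ℤ => (q.scaleRoots 2).eval ((m : ℝ) / ((n : ℕ) : ℝ)) *
        ((m : ℝ) / ((n : ℕ) : ℝ)) ^ j * dgWeight n T ((m : ℝ) / ((n : ℕ) : ℝ))) 0 from
      ⟨hs.summable, hs.tsum_eq⟩
    refine h.congr_fun fun m => ?_
    rw [intCast_div_two_mul, dgWeight_two_mul, hev, div_pow _ (2 : ℝ) j]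
    field_simp
  rw [hp.eq hq', hev]

theorem IsDGOP.dgNorm_eq {n : ℕ+} {T : ℝ} {k : ℕ} {p q : ℝ[X]} (hp : IsDGOP n T k p)
    (hq : IsDGOP (2 * n) (2 * T) k q) :
    dgNorm n T p = 2 * (2 ^ k * 2 ^ k) * dgNorm (2 * n) (2 * T) q := by
  unfold dgNorm
  have h : ∀ m : ℤ, p.eval ((m : ℝ) / ((n : ℕ) : ℝ)) ^ 2 *
      dgWeight n T ((m : ℝ) / ((n : ℕ) : ℝ)) = (2 ^ k * 2 ^ k) *
      (q.eval ((m : ℝ) / (((2 * n : ℕ+) : ℕ) : ℝ)) ^ 2 *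
        dgWeight (2 * n) (2 * T) ((m : ℝ) / (((2 * n : ℕ+) : ℕ) : ℝ))) := fun m => by
    rw [intCast_div_two_mul, dgWeight_two_mul, hp.eval_eq_two_pow_mul hq]
    ring
  rw [tsum_congr h, tsum_mul_left]
  have hn : ((n : ℕ) : ℝ) ≠ 0 := Nat.cast_ne_zero.mpr n.pos.ne'
  generalize (∑' m : ℤ, _ : ℝ) = A
  simp only [PNat.mul_coe, PNat.val_ofNat, Nat.cast_mul, Nat.cast_ofNat]
  field_simp

theorem IsDGOP.sdft_eq {n : ℕ+} {T : ℝ} {k : ℕ} {p q : ℝ[X]} (hp : IsDGOP n T k p)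
    (hq : IsDGOP (2 * n) (2 * T) k q) (a x : ℝ) :
    Sdft n a p x = 2 * 2 ^ k * Sdft (2 * n) (2 * a) q x := by
  unfold Sdft
  have hn : ((n : ℕ) : ℂ) ≠ 0 := Nat.cast_ne_zero.mpr n.pos.ne'
  have h : ∀ m : ℤ, (↑(p.eval ((m : ℝ) / ((n : ℕ) : ℝ))) : ℂ) *
      Complex.exp (-(((n : ℕ) : ℝ) : ℂ) * (a : ℂ) * (((m : ℝ) / ((n : ℕ) : ℝ) : ℝ) : ℂ) ^ 2 / 2) *
      Complex.exp (Complex.I * (((n : ℕ) : ℝ) : ℂ) * (((m : ℝ) / ((n : ℕ) : ℝ) : ℝ) : ℂ) * (x : ℂ)) =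
      2 ^ k * ((↑(q.eval ((m : ℝ) / (((2 * n : ℕ+) : ℕ) : ℝ))) : ℂ) *
      Complex.exp (-((((2 * n : ℕ+) : ℕ) : ℝ) : ℂ) * ((2 * a : ℝ) : ℂ) *
        (((m : ℝ) / (((2 * n : ℕ+) : ℕ) : ℝ) : ℝ) : ℂ) ^ 2 / 2) *
      Complex.exp (Complex.I * ((((2 * n : ℕ+) : ℕ) : ℝ) : ℂ) *
        (((m : ℝ) / (((2 * n : ℕ+) : ℕ) : ℝ) : ℝ) : ℂ) * (x : ℂ))) := fun m => by
    rw [intCast_div_two_mul, hp.eval_eq_two_pow_mul hq]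
    simp only [PNat.mul_coe, PNat.val_ofNat, Nat.cast_mul, Nat.cast_ofNat]
    push_cast
    rw [← mul_assoc, ← mul_assoc]
    congr 3
    · ring
    · ring
  rw [tsum_congr h, tsum_mul_left]
  generalize (∑' m : ℤ, _ : ℂ) = A
  simp only [PNat.mul_coe, PNat.val_ofNat, Nat.cast_mul, Nat.cast_ofNat]
  push_cast
  field_simp

theorem IsDGOP.sdft_neg {n : ℕ+} {T : ℝ} {k : ℕ} {p : ℝ[X]} (hp : IsDGOP n T k p) (a x : ℝ) :
    Sdft n a p (-x) = (-1) ^ k * Sdft n a p x := by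
  unfold Sdft
  rw [mul_left_comm]
  congr 1
  rw [← tsum_mul_left]
  refine ((Equiv.neg ℤ).tsum_eq _).symm.trans (tsum_congr fun m => ?_)
  simp only [Equiv.neg_apply, Int.cast_neg, neg_div, hp.eval_neg]
  push_cast
  rw [← mul_assoc, ← mul_assoc]
  congr 2
  · rw [neg_sq]
  · ring

theorem Finset.sum_range_two_mul_one_add_neg_one_pow (n : ℕ) (f : ℕ → ℂ) :
    ∑ k ∈ Finset.range (2 * n), (1 + (-1) ^ k) * f k =
      2 * ∑ k ∈ Finset.range n, f (2 * k) := by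
  induction n with
  | zero => simp
  | succ n ih =>
    rw [Nat.mul_succ, Finset.sum_range_succ, Finset.sum_range_succ, ih, Finset.sum_range_succ]
    simp only [pow_succ, pow_mul]
    norm_num
    ring

end

theorem reflecting_kernel_even_part (n : ℕ+) (T : ℝ) (hT : 0 < T)
    (p q : ℕ → Polynomial ℝ)
    (hp : ∀ k < 2 * (n : ℕ), IsDGOP n T k (p k))
    (hq : ∀ k < 2 * (n : ℕ), IsDGOP (2 * n) (2 * T) k (q k))
    (t₁ t₂ : ℝ) (ht₁ : t₁ ∈ Set.Ioo 0 T) (ht₂ : t₂ ∈ Set.Ioo 0 T) (x y : ℝ) :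
    Kref n T p t₁ t₂ x y =
      Kcirc (2 * n) (2 * T) q (2 * t₁) (2 * t₂) x y +
      Kcirc (2 * n) (2 * T) q (2 * t₁) (2 * t₂) x (-y) := by
  have hcirc (k : ℕ) (hk : k < 2 * (n : ℕ)) :
      ((dgNorm (2 * n) (2 * T) (q k) : ℝ) : ℂ)⁻¹ * Sdft (2 * n) (2 * T - 2 * t₁) (q k) x *
          Sdft (2 * n) (2 * t₂) (q k) (-y) +
        ((dgNorm (2 * n) (2 * T) (q k) : ℝ) : ℂ)⁻¹ * Sdft (2 * n) (2 * T - 2 * t₁) (q k) x *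
          Sdft (2 * n) (2 * t₂) (q k) (- -y) =
      (1 + (-1) ^ k) * (2⁻¹ * (((dgNorm n T (p k) : ℝ) : ℂ)⁻¹ * Sdft n (T - t₁) (p k) x *
        Sdft n t₂ (p k) (-y))) := by
    rw [(hq k hk).sdft_neg _ (-y), (hp k hk).dgNorm_eq (hq k hk),
      (hp k hk).sdft_eq (hq k hk), (hp k hk).sdft_eq (hq k hk), ← mul_sub]
    push_cast
    rw [mul_inv, mul_inv, mul_inv]
    field_simp
  unfold Kref Kcirc
  rw [← mul_add, ← Finset.sum_add_distrib]
  simp only [PNat.mul_coe, PNat.val_ofNat]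
  rw [Finset.sum_congr rfl fun k hk => hcirc k (Finset.mem_range.mp hk),
    Finset.sum_range_two_mul_one_add_neg_one_pow, ← Finset.mul_sum]
  push_cast
  field_simp
end

section
/- Let x, y ∈ ℂ, let c, d, g, a, b, h : ℝ → ℂ be arbitrary functions, and for z ∈ ℂ and s ∈ ℝ let V(z; s) = 2·M where M is the 4×4 matrix with rows (c(s), d(s), −i, 0), (d(s), c(s), 0, i), (i(−z+g(s)+a(s)), i(b(s)−h(s)), −c(s), −d(s)), (i(h(s)−b(s)), −i(z+g(s)+a(s)), −d(s), −c(s)). Suppose A, B : ℝ → Mat₄(ℂ) are differentiable with A'(s) = V(x; s)·A(s) and B'(s) = V(y; s)·B(s), and B(s) is invertible for every s. Then s ↦ B(s)^{-1}·D(x,y)·A(s) is differentiable and its derivative equals −2i(x² − y²)·B(s)^{-1}·E·A(s), where D(x,y) is the 4×4 matrix with rows (x+y, −x+y, 0, 0), (−x+y, x+y, 0, 0), (0, 0, x+y, x−y), (0, 0, x−y, x+y) and E is the 4×4 matrix whose lower-left 2×2 block is the all-ones matrix J₂ and whose other entries are 0. -/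
open Complex Matrix

/-- The coefficient matrix `V(z)` of the `s`-equation of the 4×4 Lax pair associated
to the Painlevé II equation, with parameters `c, d, g, a, b, h`. -/
def Vmat (c d g a b h z : ℂ) : Matrix (Fin 4) (Fin 4) ℂ :=
  (2 : ℂ) • !![c, d, -I, 0;
               d, c, 0, I;
               I * (-z + g + a), I * (b - h), -c, -d;
               I * (h - b), -I * (z + g + a), -d, -c]

/-- The symmetrizing matrix `D(x,y)` appearing in the hard-edge tacnode kernel. -/
def Dmat (x y : ℂ) : Matrix (Fin 4) (Fin 4) ℂ :=
  !![x + y, -x + y, 0, 0;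
     -x + y, x + y, 0, 0;
     0, 0, x + y, x - y;
     0, 0, x - y, x + y]

/-- The matrix whose lower-left 2×2 block is the all-ones matrix and whose other
entries vanish. -/
def Emat : Matrix (Fin 4) (Fin 4) ℂ :=
  !![0, 0, 0, 0;
     0, 0, 0, 0;
     1, 1, 0, 0;
     1, 1, 0, 0]

/-- The commutation defect of `D(x,y)` with the Lax coefficient matrices. -/
theorem Dmat_mul_Vmat_sub (c d g a b h x y : ℂ) :
    Dmat x y * Vmat c d g a b h x - Vmat c d g a b h y * Dmat x y =
      (-2 * I * (x ^ 2 - y ^ 2)) • Emat := by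
  ext i j
  fin_cases i <;> fin_cases j <;>
    simp [Dmat, Vmat, Emat] <;> ring

section EntrywiseDeriv

attribute [local instance] Matrix.linftyOpNormedAddCommGroup Matrix.linftyOpNormedSpace
  Matrix.linftyOpNormedRing Matrix.linftyOpNormedAlgebra

/-- Entrywise derivative of the inverse of a matrix-valued function. -/
theorem Matrix.hasDerivAt_inv_apply {n : Type*} [Fintype n] [DecidableEq n]
    {B : ℝ → Matrix n n ℂ} {B' : Matrix n n ℂ} {s : ℝ}
    (hB : ∀ i j, HasDerivAt (fun t => B t i j) (B' i j) s) (hs : IsUnit (B s)) (i j : n) :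
    HasDerivAt (fun t => (B t)⁻¹ i j) ((-((B s)⁻¹ * B' * (B s)⁻¹)) i j) s := by
  have hB₁ : HasDerivAt B B' s :=
    hasDerivAt_pi.2 fun i => hasDerivAt_pi.2 fun j => hB i j
  obtain ⟨u, hu⟩ := hs
  have hinv := hasFDerivAt_ringInverse (𝕜 := ℝ) u
  rw [hu] at hinv
  have hcomp := hinv.comp_hasDerivAt s hB₁
  have hval : (↑u⁻¹ : Matrix n n ℂ) = (B s)⁻¹ := by
    rw [← hu, Matrix.coe_units_inv]
  have hentry := hasDerivAt_pi.1 (hasDerivAt_pi.1 hcomp i) j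
  simpa [Function.comp_def, ← Matrix.nonsing_inv_eq_ringInverse, hval] using hentry

end EntrywiseDeriv

/-- Entrywise product rule for matrix-valued functions. -/
theorem Matrix.hasDerivAt_mul_apply {l m n : Type*} [Fintype m]
    {A : ℝ → Matrix l m ℂ} {B : ℝ → Matrix m n ℂ} {A' : Matrix l m ℂ} {B' : Matrix m n ℂ}
    {s : ℝ} (hA : ∀ i j, HasDerivAt (fun t => A t i j) (A' i j) s)
    (hB : ∀ i j, HasDerivAt (fun t => B t i j) (B' i j) s) (i : l) (j : n) :
    HasDerivAt (fun t => (A t * B t) i j) ((A' * B s + A s * B') i j) s := by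
  simp only [Matrix.mul_apply, Matrix.add_apply, ← Finset.sum_add_distrib]
  exact HasDerivAt.fun_sum fun k _ => (hA i k).mul (hB k j)

/-- The `s`-derivative of `s ↦ B(s)⁻¹ D A(s)` is the rank-one expression
`−2i(x² − y²) B(s)⁻¹ E A(s)`, whenever `A` and `B` solve the `s`-equations of the
Lax pair at spectral parameters `x` and `y` respectively. -/
theorem deriv_of_conjugated_kernel (x y : ℂ) (c d g a b h : ℝ → ℂ)
    (A B : ℝ → Matrix (Fin 4) (Fin 4) ℂ)
    (hA : ∀ s : ℝ, ∀ i j : Fin 4, HasDerivAt (fun s' => A s' i j)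
      ((Vmat (c s) (d s) (g s) (a s) (b s) (h s) x * A s) i j) s)
    (hB : ∀ s : ℝ, ∀ i j : Fin 4, HasDerivAt (fun s' => B s' i j)
      ((Vmat (c s) (d s) (g s) (a s) (b s) (h s) y * B s) i j) s)
    (hBinv : ∀ s : ℝ, IsUnit (B s)) :
    ∀ s : ℝ, ∀ i j : Fin 4,
      HasDerivAt (fun s' => ((B s')⁻¹ * Dmat x y * A s') i j)
        (((-2 * I * (x ^ 2 - y ^ 2)) • ((B s)⁻¹ * Emat * A s)) i j) s := by
  intro s i j
  set W := Vmat (c s) (d s) (g s) (a s) (b s) (h s) with hW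
  have hdet : IsUnit (B s).det := (Matrix.isUnit_iff_isUnit_det _).1 (hBinv s)
  have hDA := Matrix.hasDerivAt_mul_apply (A := fun _ => Dmat x y) (A' := 0)
    (fun _ _ => hasDerivAt_const _ _) (hA s)
  have hder := Matrix.hasDerivAt_mul_apply
    (Matrix.hasDerivAt_inv_apply (hB s) (hBinv s)) hDA i j
  simp only [← Matrix.mul_assoc] at hder
  convert hder using 2
  have hcomm : Dmat x y * W x = (-2 * I * (x ^ 2 - y ^ 2)) • Emat + W y * Dmat x y :=
    sub_eq_iff_eq_add.1 (Dmat_mul_Vmat_sub _ _ _ _ _ _ x y)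
  have hcancel : (B s)⁻¹ * W y * B s * (B s)⁻¹ = (B s)⁻¹ * W y :=
    Matrix.mul_nonsing_inv_cancel_right _ _ hdet
  rw [← hW, hcancel, Matrix.zero_mul, zero_add, ← Matrix.mul_assoc, Matrix.mul_assoc _ (Dmat x y),
    hcomm]
  simp only [Matrix.mul_add, Matrix.add_mul, Matrix.neg_mul, Matrix.mul_smul, Matrix.smul_mul,
    Matrix.mul_assoc]
  exact congrFun (congrFun (by abel) i) j
end

section
/- With the setup below (q a Painlevé II solution with parameter ν, q̃ its Bäcklund transform, the matrices U_ν, U_{ν+1}, R and scalar α constructed from them): if Ω ⊆ ℂ ∖ {0} is open and M : Ω → Mat₄(ℂ) is complex-differentiable with M'(z) = U_ν(z)·M(z) for all z ∈ Ω, then N(z) := (I + (α/z)·R)·Σ·M(z)·Σ is complex-differentiable on Ω and satisfies N'(z) = U_{ν+1}(z)·N(z) for all z ∈ Ω, where Σ = diag(1, −1, 1, −1). This is the Schlesinger transformation of the 4×4 Lax pair, raising the Painlevé II parameter from ν to ν+1. -/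
open Complex Matrix

/-- The coefficient matrix `U` of the `z`-equation of the 4×4 Lax pair associated to the
Painlevé II equation with parameter `μ`, built from the scalar data `c, d, G, H, τ, s`
(here `G` stands for `g + a` and `H` for `b + h`). -/
noncomputable def Umat (c d G H τ s μ : ℝ) (z : ℂ) : Matrix (Fin 4) (Fin 4) ℂ :=
  !![-(c : ℂ) + (τ : ℂ), (d : ℂ) + (μ : ℂ) / z, I, 0;
     -(d : ℂ) + (μ : ℂ) / z, (c : ℂ) - (τ : ℂ), 0, I;
     -I * (-z + (G : ℂ) + (s : ℂ)), -I * (H : ℂ), (c : ℂ) + (τ : ℂ), (d : ℂ) - (μ : ℂ) / z;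
     -I * (H : ℂ), -I * (z + (G : ℂ) + (s : ℂ)), -(d : ℂ) - (μ : ℂ) / z, -(c : ℂ) - (τ : ℂ)]

/-- The matrix `R` appearing in the Schlesinger transformation of the 4×4 Lax pair. -/
noncomputable def Rmat (β γ δ : ℝ) : Matrix (Fin 4) (Fin 4) ℂ :=
  !![(β : ℂ), (β : ℂ), -I, I;
     -(β : ℂ), -(β : ℂ), I, -I;
     I * (γ : ℂ), I * (γ : ℂ), -(δ : ℂ), (δ : ℂ);
     I * (γ : ℂ), I * (γ : ℂ), -(δ : ℂ), (δ : ℂ)]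

/-- The signature matrix `Σ = diag(1, −1, 1, −1)`. -/
noncomputable def Sig : Matrix (Fin 4) (Fin 4) ℂ :=
  !![1, 0, 0, 0;
     0, -1, 0, 0;
     0, 0, 1, 0;
     0, 0, 0, -1]

/-- The Schlesinger gauge identity `T' + T Σ U_μ Σ = U_{μ+1} T` for `T = 1 + (α/z) R`. -/
lemma schlesinger_gauge_identity (c d G H τ s ν α : ℝ)
    (h : α * (H + G + s + (c - d + τ) * (c - d - τ)) = ν + 1 / 2) {z : ℂ} (hz : z ≠ 0) :
    (-(α : ℂ) / z ^ 2) • Rmat (c - d + τ) (H + G + s) (c - d - τ) +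
        (1 + ((α : ℂ) / z) • Rmat (c - d + τ) (H + G + s) (c - d - τ)) *
          (Sig * Umat c d G H τ s ν z * Sig) =
      Umat (c - α) (α - d) (G + 2 * α * (c - d)) (-H + 2 * α * (c - d)) τ s (ν + 1) z *
        (1 + ((α : ℂ) / z) • Rmat (c - d + τ) (H + G + s) (c - d - τ)) := by
  obtain rfl : ν = α * (H + G + s + (c - d + τ) * (c - d - τ)) - 1 / 2 := by linarith
  ext i j
  fin_cases i <;> fin_cases j <;>
    simp [Umat, Rmat, Sig, Matrix.mul_apply, Fin.sum_univ_four, Matrix.one_apply] <;>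
    field_simp <;> ring_nf <;> simp only [I_sq] <;> ring

/-- The derivative of the Bäcklund transform of a Painlevé II solution. -/
lemma hasDerivAt_backlund {ν x p : ℝ} {q q' : ℝ → ℝ}
    (hq : HasDerivAt q (q' x) x) (hq' : HasDerivAt q' p x)
    (hode : p = 2 * q x ^ 3 + x * q x - ν) (hden : 2 * q x ^ 2 - 2 * q' x + x ≠ 0) :
    HasDerivAt (fun y => -q y + (2 * ν + 1) / (2 * q y ^ 2 - 2 * q' y + y))
      (-q' x + 2 * q x * ((2 * ν + 1) / (2 * q x ^ 2 - 2 * q' x + x)) -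
        ((2 * ν + 1) / (2 * q x ^ 2 - 2 * q' x + x)) ^ 2) x := by
  have hD : HasDerivAt (fun y => 2 * q y ^ 2 - 2 * q' y + y)
      (2 * ν + 1 - 2 * q x * (2 * q x ^ 2 - 2 * q' x + x)) x := by
    refine ((((hq.pow 2).const_mul 2).sub (hq'.const_mul 2)).add (hasDerivAt_id x)).congr_deriv ?_
    rw [hode]
    ring
  refine (hq.neg.add ((hasDerivAt_const x (2 * ν + 1)).div hD hden)).congr_deriv ?_
  generalize 2 * q x ^ 2 - 2 * q' x + x = D at hden ⊢
  field_simp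
  ring

/-- Entrywise product rule for `T S M S` with a constant matrix `S`. -/
lemma hasDerivAt_mul_const_mul_mul_const {n : Type*} [Fintype n] {T M : ℂ → Matrix n n ℂ}
    {T' M' S : Matrix n n ℂ} {z : ℂ}
    (hT : ∀ i j, HasDerivAt (fun w => T w i j) (T' i j) z)
    (hM : ∀ i j, HasDerivAt (fun w => M w i j) (M' i j) z) (i j : n) :
    HasDerivAt (fun w => (T w * S * M w * S) i j) ((T' * S * M z * S + T z * S * M' * S) i j) z := by
  have hmul : ∀ {A B : ℂ → Matrix n n ℂ} {A' B' : Matrix n n ℂ},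
      (∀ i j, HasDerivAt (fun w => A w i j) (A' i j) z) →
      (∀ i j, HasDerivAt (fun w => B w i j) (B' i j) z) →
      ∀ i j, HasDerivAt (fun w => (A w * B w) i j) ((A' * B z + A z * B') i j) z := by
    intro A B A' B' hA hB i j
    simp only [Matrix.mul_apply, Matrix.add_apply, ← Finset.sum_add_distrib]
    exact HasDerivAt.fun_sum fun k _ => (hA i k).mul (hB k j)
  have hS : ∀ i j, HasDerivAt (fun _ : ℂ => S i j) ((0 : Matrix n n ℂ) i j) z :=
    fun i j => hasDerivAt_const z (S i j)
  have := hmul (hmul (hmul hT hS) hM) hS i j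
  simpa [Matrix.add_mul] using this

theorem schlesinger_transformation (ν a b : ℝ) (q q' q'' : ℝ → ℝ)
    (hq : ∀ x ∈ Set.Ioo a b, HasDerivAt q (q' x) x)
    (hq' : ∀ x ∈ Set.Ioo a b, HasDerivAt q' (q'' x) x)
    (hode : ∀ x ∈ Set.Ioo a b, q'' x = 2 * q x ^ 3 + x * q x - ν)
    (hden : ∀ x ∈ Set.Ioo a b, 2 * q x ^ 2 - 2 * q' x + x ≠ 0)
    (qt : ℝ → ℝ) (hqt : ∀ x, qt x = -q x + (2 * ν + 1) / (2 * q x ^ 2 - 2 * q' x + x))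
    (u ut : ℝ → ℝ)
    (hu : ∀ x, u x = q' x ^ 2 - x * q x ^ 2 - q x ^ 4 + 2 * ν * q x)
    (hut : ∀ x, ut x = (deriv qt x) ^ 2 - x * qt x ^ 2 - qt x ^ 4 + 2 * (ν + 1) * qt x)
    (s τ σ : ℝ) (hσI : σ ∈ Set.Ioo a b) (hστ : σ = 2 ^ ((2 : ℝ) / 3) * (2 * s - τ ^ 2))
    (cq dq Gq Hq cqt dqt Gqt Hqt α β γ δ : ℝ)
    (hcq : cq = -2 ^ (-(1 : ℝ) / 3) * u σ + s ^ 2)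
    (hdq : dq = 2 ^ (-(1 : ℝ) / 3) * q σ)
    (hGq : Gq = -cq ^ 2 + dq ^ 2 + s)
    (hHq : Hq = -2 ^ ((1 : ℝ) / 3) * (q' σ + q σ * u σ) + 2 ^ ((2 : ℝ) / 3) * s ^ 2 * q σ)
    (hcqt : cqt = -2 ^ (-(1 : ℝ) / 3) * ut σ + s ^ 2)
    (hdqt : dqt = 2 ^ (-(1 : ℝ) / 3) * qt σ)
    (hGqt : Gqt = -cqt ^ 2 + dqt ^ 2 + s)
    (hHqt : Hqt = -2 ^ ((1 : ℝ) / 3) * (deriv qt σ + qt σ * ut σ) +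
      2 ^ ((2 : ℝ) / 3) * s ^ 2 * qt σ)
    (hα : α = 2 ^ (-(1 : ℝ) / 3) * (qt σ + q σ))
    (hβ : β = cq - dq + τ)
    (hγ : γ = Hq + Gq + s)
    (hδ : δ = cq - dq - τ)
    (Ω : Set ℂ) (hΩ : IsOpen Ω) (hΩ0 : (0 : ℂ) ∉ Ω)
    (M : ℂ → Matrix (Fin 4) (Fin 4) ℂ)
    (hM : ∀ z ∈ Ω, ∀ i j : Fin 4, HasDerivAt (fun w => M w i j)
      ((Umat cq dq Gq Hq τ s ν z * M z) i j) z) :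
    ∀ z ∈ Ω, ∀ i j : Fin 4,
      HasDerivAt (fun w => ((1 + ((α : ℂ) / w) • Rmat β γ δ) * Sig * M w * Sig) i j)
        ((Umat cqt dqt Gqt Hqt τ s (ν + 1) z *
          ((1 + ((α : ℂ) / z) • Rmat β γ δ) * Sig * M z * Sig)) i j) z := by
  obtain ⟨κ, hκ⟩ : ∃ κ : ℝ, κ = 2 ^ (-(1 : ℝ) / 3) := ⟨_, rfl⟩
  have hκ3 : κ ^ 3 = 1 / 2 := by
    rw [hκ, ← Real.rpow_natCast, ← Real.rpow_mul (by norm_num)]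
    norm_num [Real.rpow_neg_one]
  have hκ0 : κ ≠ 0 := by
    rintro rfl
    norm_num at hκ3
  have h1 : (2 : ℝ) ^ ((1 : ℝ) / 3) = 2 * κ ^ 2 := by
    have : κ * 2 ^ ((1 : ℝ) / 3) = 1 := by
      rw [hκ, ← Real.rpow_add (by norm_num)]
      norm_num
    apply mul_left_cancel₀ hκ0
    linear_combination this - 2 * hκ3
  have h2 : (2 : ℝ) ^ ((2 : ℝ) / 3) = 2 * κ := by
    have : κ ^ 2 * 2 ^ ((2 : ℝ) / 3) = 1 := by
      rw [hκ, ← Real.rpow_natCast, ← Real.rpow_mul (by norm_num), ← Real.rpow_add (by norm_num)]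
      norm_num
    apply mul_left_cancel₀ (pow_ne_zero 2 hκ0)
    linear_combination this - 2 * hκ3
  obtain ⟨w, hw⟩ : ∃ w, w = (2 * ν + 1) / (2 * q σ ^ 2 - 2 * q' σ + σ) := ⟨_, rfl⟩
  have hwD : w * (2 * q σ ^ 2 - 2 * q' σ + σ) = 2 * ν + 1 := by
    rw [hw, div_mul_cancel₀ _ (hden σ hσI)]
  have hqtσ : qt σ = w - q σ := by rw [hqt, ← hw]; ring
  have hdqt' : deriv qt σ = -q' σ + 2 * q σ * w - w ^ 2 := by
    rw [funext hqt, hw]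
    exact (hasDerivAt_backlund (hq σ hσI) (hq' σ hσI) (hode σ hσI) (hden σ hσI)).deriv
  have hutσ : ut σ = u σ + w := by
    rw [hut, hu, hdqt', hqtσ]
    linear_combination (2 * q σ - w) * hwD
  rw [← hκ, hqtσ] at hα hdqt
  rw [← hκ] at hcq hdq hcqt
  rw [h1, h2] at hHq hHqt
  rw [h2] at hστ
  obtain rfl : cqt = cq - α := by rw [hcqt, hcq, hα, hutσ]; ring
  obtain rfl : dqt = α - dq := by rw [hdqt, hdq, hα]; ring
  obtain rfl : Gqt = Gq + 2 * α * (cq - dq) := by rw [hGqt, hGq]; ring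
  have hHq₁ : Hq = -2 * κ ^ 2 * q' σ + 2 * dq * cq := by rw [hHq, hdq, hcq]; ring
  obtain rfl : Hqt = -Hq + 2 * α * (cq - dq) := by
    rw [hHqt, hHq₁, hdqt', hqtσ, hutσ, hα, hdq, hcq]
    ring
  have hres : α * (Hq + Gq + s + (cq - dq + τ) * (cq - dq - τ)) = ν + 1 / 2 := by
    have hκσ : κ ^ 2 * σ = 2 * s - τ ^ 2 := by
      linear_combination κ ^ 2 * hστ + 2 * (2 * s - τ ^ 2) * hκ3
    have hsum : Hq + Gq + s + (cq - dq + τ) * (cq - dq - τ) =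
        κ ^ 2 * (2 * q σ ^ 2 - 2 * q' σ + σ) := by
      rw [hHq₁, hGq]
      linear_combination 2 * (dq + κ * q σ) * hdq - hκσ
    rw [hsum, hα]
    linear_combination κ ^ 3 * hwD + (2 * ν + 1) * hκ3
  subst hβ hγ hδ
  intro z hz i j
  have hz0 : z ≠ 0 := ne_of_mem_of_not_mem hz hΩ0
  have hT : ∀ i j, HasDerivAt
      (fun w : ℂ => (1 + ((α : ℂ) / w) • Rmat (cq - dq + τ) (Hq + Gq + s) (cq - dq - τ)) i j)
      (((-(α : ℂ) / z ^ 2) • Rmat (cq - dq + τ) (Hq + Gq + s) (cq - dq - τ)) i j) z := by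
    intro i j
    simp only [Matrix.add_apply, Matrix.smul_apply, smul_eq_mul]
    refine ((((hasDerivAt_const z (α : ℂ)).div (hasDerivAt_id z) hz0).mul_const _).const_add
      _).congr_deriv ?_
    simp
  have hSig : Sig * Sig = 1 := by
    ext i j
    fin_cases i <;> fin_cases j <;> simp [Sig, Matrix.mul_apply, Fin.sum_univ_four]
  convert hasDerivAt_mul_const_mul_mul_const (S := Sig) hT (hM z hz) i j using 2
  have hgauge := schlesinger_gauge_identity cq dq Gq Hq τ s ν α hres hz0
  simp only [← Matrix.mul_assoc]
  rw [← hgauge]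
  simp only [Matrix.add_mul, Matrix.mul_assoc]
  simp only [← Matrix.mul_assoc Sig Sig, hSig, Matrix.one_mul]
end
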